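/- Let a < b be real numbers and let {Φ_n}_{n=0}^∞ be the orthonormal system obtained by Gram–Schmidt orthonormalization in L²(a,b) of the family ψ_n(t) = t^n e^t, with smooth representatives Φ_n(t) = Q_n(t) e^t. For every integer N ≥ 1, the N × N real matrix M_N with entries (M_N)_{mn} = a_{mn} = ∫_a^b Φ_m(t) Φ_n'(t) dt, for 0 ≤ m, n ≤ N−1, has determinant equal to 1; in particular M_N is invertible. -/

import Mathlib

open MeasureTheory

open Polynomial in
/-- A linear functional vanishing on `Q 0, …, Q (m - 1)`, where `Q k` has degree `k`, vanishes on
all polynomials of degree less than `m`. -/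
theorem Polynomial.linearMap_eq_zero_of_degree_lt {K V : Type*} [Field K] [AddCommGroup V]
    [Module K V] (L : K[X] →ₗ[K] V) (Q : ℕ → K[X]) (hdeg : ∀ n : ℕ, (Q n).degree = n) {m : ℕ}
    (hL : ∀ k < m, L (Q k) = 0) {p : K[X]} (hp : p.degree < m) : L p = 0 := by
  let S : Polynomial.Sequence K := ⟨Q, hdeg⟩
  have hspan := S.span_degreeLT (m := m) fun i _ =>
    (leadingCoeff_ne_zero.2 (S.ne_zero i)).isUnit
  have hle : degreeLT K m ≤ LinearMap.ker L := by
    rw [← hspan, Submodule.span_le]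
    rintro _ ⟨k, hk, rfl⟩
    exact hL k hk
  exact hle (mem_degreeLT.2 hp)

/-- The functional `p ↦ ∫ₐᵇ f p` on real polynomials, for continuous `f`. -/
noncomputable def Polynomial.intervalIntegralMul (a b : ℝ) (f : ℝ → ℝ) (hf : Continuous f) :
    Polynomial ℝ →ₗ[ℝ] ℝ where
  toFun p := ∫ t in a..b, f t * p.eval t
  map_add' p q := by
    simp only [Polynomial.eval_add, mul_add]
    exact intervalIntegral.integral_add ((hf.mul p.continuous).intervalIntegrable _ _)
      ((hf.mul q.continuous).intervalIntegrable _ _)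
  map_smul' c p := by
    simp [mul_left_comm]

/-- let `{Φ_n}` be the orthonormal system obtained by Gram–Schmidt
orthonormalization in `L²(a,b)` of the family `ψ_n(t) = t^n e^t`, with smooth
representatives `Φ_n(t) = Q_n(t) e^t`, `Q_n` a polynomial of degree exactly `n`.
For every `N ≥ 1`, the `N × N` matrix `M_N` with entries
`(M_N)_{mn} = a_{mn} = ∫_a^b Φ_m(t) Φ_n'(t) dt`, `0 ≤ m, n ≤ N−1`, has determinant `1`;
in particular `M_N` is invertible. -/
theorem matrix_of_inner_products_det_eq_one
    (a b : ℝ) (hab : a < b)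
    (Φ : ℕ → ℝ → ℝ) (Q : ℕ → Polynomial ℝ)
    (hdeg : ∀ n : ℕ, (Q n).degree = n)
    (hrep : ∀ n t, Φ n t = (Q n).eval t * Real.exp t)
    (horth : ∀ m n : ℕ, (∫ t in a..b, Φ m t * Φ n t) = if m = n then (1 : ℝ) else 0)
    (N : ℕ) (hN : 1 ≤ N)
    (M : Matrix (Fin N) (Fin N) ℝ)
    (hM : ∀ m n : Fin N, M m n = ∫ t in a..b, Φ m t * deriv (Φ n) t) :
    M.det = 1 ∧ IsUnit M := by
  have hΦ (m : ℕ) : Continuous fun t => Φ m t * Real.exp t := by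
    simp only [hrep]
    fun_prop
  let L (m : ℕ) := Polynomial.intervalIntegralMul a b _ (hΦ m)
  have hL (m n : ℕ) : L m (Q n) = if m = n then 1 else 0 := by
    rw [← horth m n]
    refine intervalIntegral.integral_congr fun t _ => ?_
    simp only [hrep n]
    ring
  have hderiv (n : ℕ) (t : ℝ) :
      deriv (Φ n) t = (Q n + (Q n).derivative).eval t * Real.exp t := by
    rw [show Φ n = fun t => (Q n).eval t * Real.exp t from funext (hrep n),
      (((Q n).hasDerivAt t).fun_mul (Real.hasDerivAt_exp t)).deriv, Polynomial.eval_add]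
    ring
  have hML (m n : Fin N) : M m n = L m (Q n) + L m (Q n).derivative := by
    rw [hM, ← map_add]
    refine intervalIntegral.integral_congr fun t _ => ?_
    simp only [hderiv]
    ring
  have hvanish {m n : ℕ} (hnm : n ≤ m) : L m (Q n).derivative = 0 := by
    refine Polynomial.linearMap_eq_zero_of_degree_lt (L m) Q hdeg
      (fun k hk => by rw [hL, if_neg hk.ne']) ?_
    have hQ : Q n ≠ 0 := fun h => by simpa [h] using hdeg n
    refine (Polynomial.degree_derivative_lt hQ).trans_le ?_
    rw [hdeg]
    exact_mod_cast hnm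
  have htri : M.BlockTriangular id := fun m n (hnm : n < m) => by
    rw [hML, hvanish hnm.le, hL, if_neg (Fin.val_ne_of_ne hnm.ne'), add_zero]
  have hdet : M.det = 1 := by
    rw [Matrix.det_of_isUpperTriangular htri]
    exact Finset.prod_eq_one fun n _ => by rw [hML, hvanish le_rfl, hL, if_pos rfl, add_zero]
  exact ⟨hdet, (Matrix.isUnit_iff_isUnit_det M).2 (hdet ▸ isUnit_one)⟩
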